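/- Let A, B, C, D, E, F be six distinct points of ℙ²(ℂ) on an irreducible conic, no three collinear. Let p₁ be the generalized Pascal line of the reducible cubics l(AB)·l(DF)·l(CE) and l(AC)·l(EF)·l(BD); p₂ of l(AC)·l(BF)·l(DE) and l(AE)·l(BC)·l(DF); p₄ of l(AB)·l(DE)·l(CF) and l(AF)·l(BE)·l(CD); q₁ of l(AB)·l(DF)·l(CE) and l(AE)·l(BF)·l(CD); q₂ of l(AC)·l(BF)·l(DE) and l(AF)·l(BD)·l(CE); q₄ of l(AB)·l(DE)·l(CF) and l(AD)·l(BC)·l(EF), assuming each of these six pairs of cubics satisfies the hypotheses for a generalized Pascal line and that pᵢ ≠ qᵢ for i ∈ {1,2,4}. Then the two Kirkman points p₁ ∩ q₁ and p₂ ∩ q₂ and the Steiner point p₄ ∩ q₄ are collinear. -/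

import Mathlib

open MvPolynomial

noncomputable section

/-- Polynomials in three variables over `ℂ`. -/
abbrev Poly3 : Type := MvPolynomial (Fin 3) ℂ

/-- The complex projective plane `ℙ²(ℂ)`, the projectivization of `ℂ³`. -/
abbrev ProjPlane : Type := Projectivization ℂ (Fin 3 → ℂ)

/-- A (homogeneous) polynomial vanishes at a projective point if it vanishes at its
canonical nonzero representative vector (for homogeneous polynomials this is equivalent
to vanishing at any nonzero representative vector). -/
def VanishesAt (F : Poly3) (p : ProjPlane) : Prop :=
  MvPolynomial.eval p.rep F = 0

/-- The set of points of `ℙ²(ℂ)` at which `F` vanishes. -/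
def zeroSet (F : Poly3) : Set ProjPlane := {p | VanishesAt F p}

/-- Two defining polynomials give the same curve iff they are proportional by a
nonzero scalar. -/
def ProportionalTo (F G : Poly3) : Prop := ∃ c : ℂ, c ≠ 0 ∧ G = c • F

/-- A set of points is collinear if some nonzero homogeneous polynomial of degree 1
vanishes at all of them. -/
def Collin (s : Set ProjPlane) : Prop :=
  ∃ L : Poly3, L ≠ 0 ∧ L.IsHomogeneous 1 ∧ ∀ p ∈ s, VanishesAt L p

/-- No three distinct points of `s` are collinear. -/
def NoThreeCollinear (s : Set ProjPlane) : Prop :=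
  ∀ p q r, p ∈ s → q ∈ s → r ∈ s → p ≠ q → p ≠ r → q ≠ r → ¬ Collin {p, q, r}

/-- `L` is a (the) line through the points `p` and `q`. -/
def IsLineThrough (L : Poly3) (p q : ProjPlane) : Prop :=
  L ≠ 0 ∧ L.IsHomogeneous 1 ∧ VanishesAt L p ∧ VanishesAt L q

/-- `L` is the generalized Pascal line of the cubics `D₁` and `D₂` with respect to six
points `A, …, F`: the cubics have no common nonconstant factor, their common zero set
consists of exactly nine distinct points (the six given ones plus three further points),
and `L` is the line through the three further intersection points. -/
def IsGenPascalLine (A B C D E F : ProjPlane) (D₁ D₂ L : Poly3) : Prop :=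
  IsRelPrime D₁ D₂ ∧ L ≠ 0 ∧ L.IsHomogeneous 1 ∧
    ∃ P Q R : ProjPlane,
      ([A, B, C, D, E, F, P, Q, R] : List ProjPlane).Pairwise (· ≠ ·) ∧
      zeroSet D₁ ∩ zeroSet D₂ = {A, B, C, D, E, F, P, Q, R} ∧
      VanishesAt L P ∧ VanishesAt L Q ∧ VanishesAt L R

open Matrix

/-- The point `(s² : s t : t²)` of the standard conic. -/
def veronese (p : ℂ × ℂ) : Fin 3 → ℂ := ![p.1 ^ 2, p.1 * p.2, p.2 ^ 2]

/-- The bracket (determinant) of two vectors of `ℂ²`. -/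
def bracket (p q : ℂ × ℂ) : ℂ := p.1 * q.2 - q.1 * p.2

/-- The coefficients of the line joining two points of the standard conic. -/
def chord (p q : ℂ × ℂ) : Fin 3 → ℂ :=
  ![p.2 * q.2, -(p.1 * q.2 + q.1 * p.2), p.1 * q.1]

/-- The coefficients of `x y²`, `y³`, `y² z` in the product of three linear forms. -/
def middleCoeffs (u v w : Fin 3 → ℂ) : Fin 3 → ℂ :=
  ![u 0 * v 1 * w 1 + u 1 * v 0 * w 1 + u 1 * v 1 * w 0, u 1 * v 1 * w 1,
    u 2 * v 1 * w 1 + u 1 * v 2 * w 1 + u 1 * v 1 * w 2]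

/-- The Pascal line of the hexagon `a b c d e f` inscribed in the standard conic. -/
def pascalVec (a b c d e f : ℂ × ℂ) : Fin 3 → ℂ :=
  middleCoeffs (chord a b) (chord c d) (chord e f) -
    middleCoeffs (chord b c) (chord d e) (chord f a)

lemma chord_dotProduct_veronese (p q r : ℂ × ℂ) :
    chord p q ⬝ᵥ veronese r = bracket p r * bracket q r := by
  simp [chord, veronese, bracket, dotProduct, Fin.sum_univ_three]
  ring

lemma chord_prod_sub_chord_prod (a b c d e f : ℂ × ℂ) (u : Fin 3 → ℂ) :
    (chord a b ⬝ᵥ u) * (chord c d ⬝ᵥ u) * (chord e f ⬝ᵥ u) -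
        (chord b c ⬝ᵥ u) * (chord d e ⬝ᵥ u) * (chord f a ⬝ᵥ u) =
      (u 1 ^ 2 - u 0 * u 2) * (pascalVec a b c d e f ⬝ᵥ u) := by
  simp [pascalVec, middleCoeffs, chord, dotProduct, Fin.sum_univ_three]
  ring

lemma exists_dotProduct_of_isHomogeneous_one {L : Poly3} (hL : L.IsHomogeneous 1) :
    ∃ w : Fin 3 → ℂ, ∀ v, eval v L = w ⬝ᵥ v := by
  rw [L.as_sum]
  refine Finset.sum_induction _ (fun F : Poly3 => ∃ w : Fin 3 → ℂ, ∀ v, eval v F = w ⬝ᵥ v)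
    ?_ ⟨0, by simp⟩ ?_
  · rintro F G ⟨w, hw⟩ ⟨w', hw'⟩
    exact ⟨w + w', fun v => by rw [map_add, hw, hw', add_dotProduct]⟩
  · intro m hm
    obtain ⟨i, rfl⟩ := (Finsupp.sum_eq_one_iff m).1 (by_contra fun h =>
      mem_support_iff.1 hm (hL.coeff_eq_zero h))
    exact ⟨Pi.single i (coeff (Finsupp.single i 1) L), fun v => by simp [eval_monomial]⟩

lemma exists_quadratic_of_isHomogeneous_two {K : Poly3} (hK : K.IsHomogeneous 2) :
    ∃ q : Fin 6 → ℂ, ∀ v, eval v K = q 0 * v 0 ^ 2 + q 1 * v 1 ^ 2 + q 2 * v 2 ^ 2 +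
      q 3 * (v 1 * v 2) + q 4 * (v 0 * v 2) + q 5 * (v 0 * v 1) := by
  rw [K.as_sum]
  refine Finset.sum_induction _ (fun F : Poly3 => ∃ q : Fin 6 → ℂ, ∀ v, eval v F =
      q 0 * v 0 ^ 2 + q 1 * v 1 ^ 2 + q 2 * v 2 ^ 2 +
      q 3 * (v 1 * v 2) + q 4 * (v 0 * v 2) + q 5 * (v 0 * v 1)) ?_ ?_ ?_
  · rintro F G ⟨q, hq⟩ ⟨r, hr⟩
    refine ⟨q + r, fun v => ?_⟩
    simp only [map_add, hq, hr, Pi.add_apply]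
    ring
  · exact ⟨0, by simp⟩
  · intro m hm
    have hd : m.degree = 2 := by_contra fun h => mem_support_iff.1 hm (hK.coeff_eq_zero h)
    rw [Finsupp.degree_eq_sum, Fin.sum_univ_three] at hd
    have hcases : (m 0 = 2 ∧ m 1 = 0 ∧ m 2 = 0) ∨ (m 0 = 0 ∧ m 1 = 2 ∧ m 2 = 0) ∨
        (m 0 = 0 ∧ m 1 = 0 ∧ m 2 = 2) ∨ (m 0 = 0 ∧ m 1 = 1 ∧ m 2 = 1) ∨
        (m 0 = 1 ∧ m 1 = 0 ∧ m 2 = 1) ∨ (m 0 = 1 ∧ m 1 = 1 ∧ m 2 = 0) := by omega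
    simp only [eval_monomial, Finsupp.prod_fintype, Fin.prod_univ_three, pow_zero, implies_true]
    generalize coeff m K = c
    rcases hcases with h | h | h | h | h | h
    · exact ⟨Pi.single 0 c, fun v => by simp [h]⟩
    · exact ⟨Pi.single 1 c, fun v => by simp [h]⟩
    · exact ⟨Pi.single 2 c, fun v => by simp [h]⟩
    · exact ⟨Pi.single 3 c, fun v => by simp [h]⟩
    · exact ⟨Pi.single 4 c, fun v => by simp [h]⟩
    · exact ⟨Pi.single 5 c, fun v => by simp [h]⟩

lemma eq_of_rep_eq_smul {P Q : ProjPlane} {c : ℂ} (h : P.rep = c • Q.rep) : P = Q := by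
  rw [← P.mk_rep, ← Q.mk_rep, Projectivization.mk_eq_mk_iff']
  exact ⟨c, h.symm⟩

lemma exists_eq_smul_veronese {u : Fin 3 → ℂ} (h : u 1 ^ 2 - u 0 * u 2 = 0) :
    ∃ (c : ℂ) (p : ℂ × ℂ), u = c • veronese p := by
  by_cases h0 : u 0 = 0
  · have h1 : u 1 = 0 := by simpa [h0] using h
    exact ⟨u 2, (0, 1), by ext i; fin_cases i <;> simp [veronese, h0, h1]⟩
  · refine ⟨(u 0)⁻¹, (u 0, u 1), ?_⟩
    ext i
    fin_cases i <;> simp [veronese] <;> field_simp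
    linear_combination -h

lemma det_ne_zero_of_not_collin {P Q R : ProjPlane} (h : ¬ Collin {P, Q, R}) :
    (of ![P.rep, Q.rep, R.rep]).det ≠ 0 := by
  intro h0
  obtain ⟨w, hw, hw0⟩ := exists_mulVec_eq_zero_iff.2 h0
  have heval : ∀ v, eval v (∑ i, C (w i) * X i : Poly3) = v ⬝ᵥ w := fun v => by
    simp [dotProduct, mul_comm]
  refine h ⟨∑ i, C (w i) * X i, fun hz => hw ?_,
    IsHomogeneous.sum _ _ _ fun i _ => isHomogeneous_C_mul_X _ _, ?_⟩
  · ext i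
    simpa [hz] using (heval (Pi.single i 1)).symm
  · have h0 := congrFun hw0 0
    have h1 := congrFun hw0 1
    have h2 := congrFun hw0 2
    simp only [mulVec, of_apply, cons_val, Pi.zero_apply] at h0 h1 h2
    rintro p (rfl | rfl | rfl) <;> rw [VanishesAt, heval] <;> assumption

lemma exists_vecMul_eq {M : Matrix (Fin 3) (Fin 3) ℂ} (hM : M.det ≠ 0) (v : Fin 3 → ℂ) :
    ∃ u, v = u ᵥ* M :=
  ⟨v ᵥ* M⁻¹, by rw [vecMul_vecMul, nonsing_inv_mul _ hM.isUnit, vecMul_one]⟩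

lemma exists_pullback {M : Matrix (Fin 3) (Fin 3) ℂ} (hM : M.det ≠ 0) {L : Poly3} (hL : L ≠ 0)
    (hLh : L.IsHomogeneous 1) : ∃ w ≠ 0, ∀ u, eval (u ᵥ* M) L = w ⬝ᵥ u := by
  obtain ⟨w, hw⟩ := exists_dotProduct_of_isHomogeneous_one hLh
  have key : ∀ u, eval (u ᵥ* M) L = (M *ᵥ w) ⬝ᵥ u := fun u => by
    rw [hw, dotProduct_comm, ← dotProduct_mulVec, dotProduct_comm]
  refine ⟨M *ᵥ w, fun h0 => hL (MvPolynomial.funext fun v => ?_), key⟩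
  obtain ⟨u, rfl⟩ := exists_vecMul_eq hM v
  simp [key, h0]

lemma exists_eq_smul_cross {w x y : Fin 3 → ℂ} (hx : w ⬝ᵥ x = 0) (hy : w ⬝ᵥ y = 0)
    (hxy : x ⨯₃ y ≠ 0) : ∃ k : ℂ, w = k • (x ⨯₃ y) := by
  have h0 : w ⨯₃ (x ⨯₃ y) = 0 := by
    rw [cross_cross_eq_smul_sub_smul', dotProduct_comm x, hx, hy]
    simp
  obtain ⟨i, hi⟩ := Function.ne_iff.1 hxy
  generalize x ⨯₃ y = n at *
  refine ⟨w i / n i, ?_⟩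
  have e0 := congrFun h0 0
  have e1 := congrFun h0 1
  have e2 := congrFun h0 2
  simp [cross_apply] at e0 e1 e2 hi
  ext j
  rw [Pi.smul_apply, smul_eq_mul, div_mul_eq_mul_div, eq_div_iff hi]
  fin_cases i <;> fin_cases j <;> simp <;> grind

/-- The point `P` is the image of the point of the standard conic with parameter `p` under the
projective map with matrix `M`. -/
def IsParam (M : Matrix (Fin 3) (Fin 3) ℂ) (P : ProjPlane) (p : ℂ × ℂ) : Prop :=
  ∃ c : ℂ, c ≠ 0 ∧ P.rep = (c • veronese p) ᵥ* M

lemma IsParam.bracket_ne_zero {M : Matrix (Fin 3) (Fin 3) ℂ} {P Q : ProjPlane} {p q : ℂ × ℂ}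
    (hP : IsParam M P p) (hQ : IsParam M Q q) (hPQ : P ≠ Q) : bracket p q ≠ 0 := by
  obtain ⟨c, hc, hP⟩ := hP
  obtain ⟨d, hd, hQ⟩ := hQ
  intro h
  have hq : q ≠ 0 := by
    rintro rfl
    apply Q.rep_nonzero
    rw [hQ]
    ext i
    simp [veronese, vecMul, dotProduct, Fin.sum_univ_three]
  obtain ⟨k, rfl⟩ : ∃ k : ℂ, p = k • q := by
    unfold bracket at h
    by_cases h1 : q.1 = 0
    · have h2 : q.2 ≠ 0 := fun h2 => hq (Prod.ext h1 h2)
      refine ⟨p.2 / q.2, Prod.ext ?_ ?_⟩ <;> simp <;> field_simp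
      linear_combination h
    · refine ⟨p.1 / q.1, Prod.ext ?_ ?_⟩ <;> simp <;> field_simp
      linear_combination -h
  refine hPQ (eq_of_rep_eq_smul (c := c * k ^ 2 / d) ?_)
  rw [hP, hQ, ← smul_vecMul, smul_smul, div_mul_cancel₀ _ hd]
  congr 1
  ext i
  fin_cases i <;> simp [veronese] <;> ring

lemma veronese_cross_veronese (p q : ℂ × ℂ) :
    veronese p ⨯₃ veronese q = bracket p q • chord p q := by
  ext i
  fin_cases i <;> simp [cross_apply, veronese, bracket, chord] <;> ring

lemma chord_ne_zero {p q : ℂ × ℂ} (h : bracket p q ≠ 0) : chord p q ≠ 0 := by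
  intro h0
  have e0 := congrFun h0 0
  have e1 := congrFun h0 1
  have e2 := congrFun h0 2
  simp [chord] at e0 e1 e2
  apply h
  have : bracket p q ^ 2 = 0 := by
    unfold bracket
    rcases e0 with e0 | e0 <;> rcases e2 with e2 | e2 <;> simp [e0, e2] at e1 ⊢ <;> grind
  simpa using this

lemma IsLineThrough.symm {L : Poly3} {P Q : ProjPlane} (h : IsLineThrough L P Q) :
    IsLineThrough L Q P :=
  ⟨h.1, h.2.1, h.2.2.2, h.2.2.1⟩

lemma IsParam.dotProduct_eq_zero {M : Matrix (Fin 3) (Fin 3) ℂ} {P : ProjPlane} {p : ℂ × ℂ}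
    (hP : IsParam M P p) {L : Poly3} {w : Fin 3 → ℂ} (hw : ∀ u, eval (u ᵥ* M) L = w ⬝ᵥ u)
    (hL : VanishesAt L P) : w ⬝ᵥ veronese p = 0 := by
  obtain ⟨c, hc, hP⟩ := hP
  rw [VanishesAt, hP, hw, dotProduct_smul] at hL
  simpa [hc] using hL

lemma IsLineThrough.exists_eval_eq {M : Matrix (Fin 3) (Fin 3) ℂ} (hM : M.det ≠ 0)
    {L : Poly3} {P Q : ProjPlane} {p q : ℂ × ℂ} (hL : IsLineThrough L P Q)
    (hP : IsParam M P p) (hQ : IsParam M Q q) (hPQ : P ≠ Q) :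
    ∃ k : ℂ, k ≠ 0 ∧ ∀ u, eval (u ᵥ* M) L = k * (chord p q ⬝ᵥ u) := by
  obtain ⟨hL0, hLh, hLP, hLQ⟩ := hL
  obtain ⟨w, hw0, hw⟩ := exists_pullback hM hL0 hLh
  have hb := hP.bracket_ne_zero hQ hPQ
  obtain ⟨k, rfl⟩ := exists_eq_smul_cross (hP.dotProduct_eq_zero hw hLP)
    (hQ.dotProduct_eq_zero hw hLQ)
    (by rw [veronese_cross_veronese]; exact smul_ne_zero hb (chord_ne_zero hb))
  rw [veronese_cross_veronese, smul_smul] at hw hw0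
  refine ⟨_, (smul_ne_zero_iff.1 hw0).1, fun u => ?_⟩
  rw [hw, smul_dotProduct, smul_eq_mul]


lemma IsGenPascalLine.exists_eval_eq {M : Matrix (Fin 3) (Fin 3) ℂ} (hM : M.det ≠ 0)
    {A B C D E F : ProjPlane} {a b c d e f : ℂ × ℂ}
    (hA : IsParam M A a) (hB : IsParam M B b) (hC : IsParam M C c)
    (hD : IsParam M D d) (hE : IsParam M E e) (hF : IsParam M F f)
    {A' B' C' D' E' F' : ProjPlane} {D₁ D₂ L : Poly3}
    (hL : IsGenPascalLine A' B' C' D' E' F' D₁ D₂ L)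
    (hmem : ∀ X ∈ [A, B, C, D, E, F], X ∈ [A', B', C', D', E', F'])
    (hne : [A, B, C, D, E, F].Nodup)
    {l₁ l₂ l₃ l₄ l₅ l₆ : Poly3}
    (h₁ : IsLineThrough l₁ A B) (h₂ : IsLineThrough l₂ C D) (h₃ : IsLineThrough l₃ E F)
    (h₄ : IsLineThrough l₄ B C) (h₅ : IsLineThrough l₅ D E) (h₆ : IsLineThrough l₆ F A)
    (hD₁ : D₁ = l₁ * l₂ * l₃) (hD₂ : D₂ = l₄ * l₅ * l₆) :
    ∃ k : ℂ, k ≠ 0 ∧ ∀ u, eval (u ᵥ* M) L = k * (pascalVec a b c d e f ⬝ᵥ u) := by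
  obtain ⟨hrel, hL0, hLh, P, Q, R, hpw, hzero, hLP, hLQ, -⟩ := hL
  simp only [List.nodup_cons, List.mem_cons, List.not_mem_nil, not_or] at hne
  obtain ⟨k₁, hk₁, e₁⟩ := h₁.exists_eval_eq hM hA hB (by tauto)
  obtain ⟨k₂, hk₂, e₂⟩ := h₂.exists_eval_eq hM hC hD (by tauto)
  obtain ⟨k₃, hk₃, e₃⟩ := h₃.exists_eval_eq hM hE hF (by tauto)
  obtain ⟨k₄, hk₄, e₄⟩ := h₄.exists_eval_eq hM hB hC (by tauto)
  obtain ⟨k₅, hk₅, e₅⟩ := h₅.exists_eval_eq hM hD hE (by tauto)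
  obtain ⟨k₆, hk₆, e₆⟩ := h₆.exists_eval_eq hM hF hA (by tauto)
  have E₁ : ∀ u, eval (u ᵥ* M) D₁ =
      k₁ * k₂ * k₃ * ((chord a b ⬝ᵥ u) * (chord c d ⬝ᵥ u) * (chord e f ⬝ᵥ u)) := fun u => by
    rw [hD₁, map_mul, map_mul, e₁, e₂, e₃]; ring
  have E₂ : ∀ u, eval (u ᵥ* M) D₂ =
      k₄ * k₅ * k₆ * ((chord b c ⬝ᵥ u) * (chord d e ⬝ᵥ u) * (chord f a ⬝ᵥ u)) := fun u => by
    rw [hD₂, map_mul, map_mul, e₄, e₅, e₆]; ring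
  have hvec : pascalVec a b c d e f ≠ 0 := by
    intro h0
    have hfac : D₁ = MvPolynomial.C (k₁ * k₂ * k₃ / (k₄ * k₅ * k₆)) * D₂ := by
      refine MvPolynomial.funext fun v => ?_
      obtain ⟨u, rfl⟩ := exists_vecMul_eq hM v
      have := chord_prod_sub_chord_prod a b c d e f u
      rw [h0, zero_dotProduct, mul_zero, sub_eq_zero] at this
      rw [map_mul, eval_C, E₁, E₂, this]
      field_simp
    have hu : IsUnit D₂ := hrel ⟨_, by rw [hfac, mul_comm]⟩ dvd_rfl
    have := hu.map (eval B.rep)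
    rw [hD₂, map_mul, map_mul, show eval B.rep l₄ = 0 from h₄.2.2.1] at this
    simp at this
  have hpascal : ∀ X : ProjPlane, X ∈ zeroSet D₁ ∩ zeroSet D₂ →
      (∀ Y ∈ [A', B', C', D', E', F'], Y ≠ X) →
      ∀ u, X.rep = u ᵥ* M → pascalVec a b c d e f ⬝ᵥ u = 0 := by
    rintro X ⟨hX₁, hX₂⟩ hX u hu
    replace hX : ∀ Y ∈ [A, B, C, D, E, F], Y ≠ X := fun Y hY => hX Y (hmem Y hY)
    simp only [List.forall_mem_cons, List.not_mem_nil, false_imp_iff, implies_true,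
      and_true] at hX
    change eval X.rep D₁ = 0 at hX₁
    change eval X.rep D₂ = 0 at hX₂
    rw [hu, E₁] at hX₁
    rw [hu, E₂] at hX₂
    replace hX₁ := (mul_eq_zero.1 hX₁).resolve_left (by positivity)
    replace hX₂ := (mul_eq_zero.1 hX₂).resolve_left (by positivity)
    have hprod := chord_prod_sub_chord_prod a b c d e f u
    rw [hX₁, hX₂, sub_zero, eq_comm, mul_eq_zero] at hprod
    refine hprod.resolve_left fun hcon => ?_
    obtain ⟨s, r, rfl⟩ := exists_eq_smul_veronese hcon
    have hs : s ≠ 0 := by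
      rintro rfl
      exact X.rep_nonzero (by simp [hu])
    have hXr : IsParam M X r := ⟨s, hs, hu⟩
    simp only [dotProduct_smul, chord_dotProduct_veronese, smul_eq_mul, mul_eq_zero, hs,
      false_or, hA.bracket_ne_zero hXr hX.1, hB.bracket_ne_zero hXr hX.2.1,
      hC.bracket_ne_zero hXr hX.2.2.1, hD.bracket_ne_zero hXr hX.2.2.2.1,
      hE.bracket_ne_zero hXr hX.2.2.2.2.1, hF.bracket_ne_zero hXr hX.2.2.2.2.2] at hX₁
  obtain ⟨x, hx⟩ := exists_vecMul_eq hM P.rep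
  obtain ⟨y, hy⟩ := exists_vecMul_eq hM Q.rep
  simp only [List.pairwise_cons, List.mem_cons, List.not_mem_nil, or_false, forall_eq_or_imp,
    forall_eq] at hpw
  have hx0 := hpascal P (by rw [hzero]; simp) (by simp; tauto) x hx
  have hy0 := hpascal Q (by rw [hzero]; simp) (by simp; tauto) y hy
  have hxy : x ⨯₃ y ≠ 0 := by
    rw [crossProduct_ne_zero_iff_linearIndependent]
    have hPQ : LinearIndependent ℂ ![P.rep, Q.rep] :=
      Projectivization.linearIndependent_pair_iff_ne.2 (by tauto)
    refine LinearIndependent.of_comp M.vecMulLinear ?_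
    have hcomp : M.vecMulLinear ∘ ![x, y] = ![P.rep, Q.rep] := by
      ext i : 1
      fin_cases i <;> simp [hx, hy]
    rw [hcomp]
    exact hPQ
  obtain ⟨w, hw0, hw⟩ := exists_pullback hM hL0 hLh
  obtain ⟨k, rfl⟩ := exists_eq_smul_cross (w := w) (by rw [← hw, ← hx]; exact hLP)
    (by rw [← hw, ← hy]; exact hLQ) hxy
  obtain ⟨k', hk'⟩ := exists_eq_smul_cross hx0 hy0 hxy
  have hk0 := (smul_ne_zero_iff.1 hw0).1
  have hk'0 : k' ≠ 0 := by
    rintro rfl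
    exact hvec (by rw [hk', zero_smul])
  refine ⟨k / k', div_ne_zero hk0 hk'0, fun u => ?_⟩
  rw [hw, hk']
  simp only [smul_dotProduct, smul_eq_mul]
  field_simp

lemma vecMul_of_three (u x y z : Fin 3 → ℂ) :
    u ᵥ* of ![x, y, z] = u 0 • x + u 1 • y + u 2 • z := by
  ext i
  simp only [vecMul, dotProduct, Fin.sum_univ_three, of_apply, cons_val]
  rfl

lemma coords_ne_zero {P Q R X : ProjPlane} {δ : Fin 3 → ℂ}
    (hδ : X.rep = δ ᵥ* of ![P.rep, Q.rep, R.rep]) (h0 : ¬ Collin {Q, R, X})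
    (h1 : ¬ Collin {P, R, X}) (h2 : ¬ Collin {P, Q, X}) : δ 0 ≠ 0 ∧ δ 1 ≠ 0 ∧ δ 2 ≠ 0 := by
  replace h0 := det_ne_zero_of_not_collin h0
  replace h1 := det_ne_zero_of_not_collin h1
  replace h2 := det_ne_zero_of_not_collin h2
  refine ⟨fun h => h0 ?_, fun h => h1 ?_, fun h => h2 ?_⟩ <;>
  · rw [hδ, vecMul_of_three]
    simp [det_fin_three, h]
    ring

lemma minors_ne_zero {P Q R X Y : ProjPlane} {δ ε : Fin 3 → ℂ}
    (hδ : X.rep = δ ᵥ* of ![P.rep, Q.rep, R.rep]) (hε : Y.rep = ε ᵥ* of ![P.rep, Q.rep, R.rep])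
    (h0 : ¬ Collin {P, X, Y}) (h1 : ¬ Collin {Q, X, Y}) (h2 : ¬ Collin {R, X, Y}) :
    δ 1 * ε 2 - δ 2 * ε 1 ≠ 0 ∧ δ 0 * ε 2 - δ 2 * ε 0 ≠ 0 ∧ δ 0 * ε 1 - δ 1 * ε 0 ≠ 0 := by
  replace h0 := det_ne_zero_of_not_collin h0
  replace h1 := det_ne_zero_of_not_collin h1
  replace h2 := det_ne_zero_of_not_collin h2
  rw [hδ, hε, vecMul_of_three, vecMul_of_three] at h0 h1 h2
  have hdet := det_fin_three (of ![P.rep, Q.rep, R.rep])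
  simp at hdet
  refine ⟨fun h => h0 ?_, fun h => h1 ?_, fun h => h2 ?_⟩ <;> simp [det_fin_three]
  · linear_combination (of ![P.rep, Q.rep, R.rep]).det * h - (δ 1 * ε 2 - δ 2 * ε 1) * hdet
  · linear_combination -(of ![P.rep, Q.rep, R.rep]).det * h + (δ 0 * ε 2 - δ 2 * ε 0) * hdet
  · linear_combination (of ![P.rep, Q.rep, R.rep]).det * h - (δ 0 * ε 1 - δ 1 * ε 0) * hdet

/-- If one coefficient of a conic through the coordinate points vanishes, two suitable further
points force it to be zero. -/
lemma conic_coeffs_eq_zero {β γ d₁ d₂ d₃ e₁ e₂ e₃ : ℂ}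
    (hd : γ * (d₁ * d₂) + β * (d₁ * d₃) = 0) (he : γ * (e₁ * e₂) + β * (e₁ * e₃) = 0)
    (hd₁ : d₁ ≠ 0) (he₁ : e₁ ≠ 0) (h : d₂ * e₃ - d₃ * e₂ ≠ 0) : β = 0 ∧ γ = 0 := by
  have hd' : γ * d₂ + β * d₃ = 0 := by
    apply mul_left_cancel₀ hd₁
    linear_combination hd
  have he' : γ * e₂ + β * e₃ = 0 := by
    apply mul_left_cancel₀ he₁
    linear_combination he
  constructor <;> apply mul_right_cancel₀ h
  · linear_combination d₂ * he' - e₂ * hd'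
  · linear_combination e₃ * hd' - d₃ * he'

/-- A parametrization of a conic through three points, given in coordinates with respect to these
points. -/
lemma isParam_of_coords {P Q R X : ProjPlane} {δ : Fin 3 → ℂ} {α β γ : ℂ}
    (hα : α ≠ 0) (hβ : β ≠ 0) (hγ : γ ≠ 0)
    (hδ : X.rep = δ ᵥ* of ![P.rep, Q.rep, R.rep])
    (h : γ * (δ 0 * δ 1) + β * (δ 0 * δ 2) + α * (δ 1 * δ 2) = 0)
    (h0 : δ 0 ≠ 0 ∧ δ 1 ≠ 0 ∧ δ 2 ≠ 0) :
    IsParam (of ![α • P.rep, γ • R.rep - α • P.rep - β • Q.rep, β • Q.rep]) X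
      (-(β * δ 0) / (α * δ 1), 1) := by
  obtain ⟨h0, h1, h2⟩ := h0
  refine ⟨-(α * δ 1 * δ 2) / (β * γ * δ 0), by simp [*], ?_⟩
  rw [hδ, vecMul_of_three, vecMul_of_three]
  ext i
  simp [veronese]
  field_simp
  grind

lemma exists_isParam {A B C D E F : ProjPlane}
    (hdist : ([A, B, C, D, E, F] : List ProjPlane).Pairwise (· ≠ ·))
    {K : Poly3} (hKh : K.IsHomogeneous 2) (hK0 : K ≠ 0)
    (honK : ∀ p ∈ [A, B, C, D, E, F], VanishesAt K p)
    (hn3 : NoThreeCollinear {A, B, C, D, E, F}) :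
    ∃ M : Matrix (Fin 3) (Fin 3) ℂ, M.det ≠ 0 ∧ IsParam M A (1, 0) ∧ IsParam M B (0, 1) ∧
      IsParam M C (1, 1) ∧ ∃ d e f : ℂ, IsParam M D (d, 1) ∧ IsParam M E (e, 1) ∧
      IsParam M F (f, 1) := by
  simp only [List.pairwise_cons, List.mem_cons, List.not_mem_nil, or_false, forall_eq_or_imp,
    forall_eq, VanishesAt] at hdist honK
  have hABC := det_ne_zero_of_not_collin (hn3 A B C (by simp) (by simp) (by simp)
    (by tauto) (by tauto) (by tauto))
  have hco : ∀ X ∈ ({A, B, C, D, E, F} : Set ProjPlane), X ≠ A → X ≠ B → X ≠ C →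
      ∀ δ, X.rep = δ ᵥ* of ![A.rep, B.rep, C.rep] → δ 0 ≠ 0 ∧ δ 1 ≠ 0 ∧ δ 2 ≠ 0 :=
    fun X hX h₁ h₂ h₃ δ hδ => coords_ne_zero hδ
      (hn3 _ _ _ (by simp) (by simp) hX (by tauto) (by tauto) (by tauto))
      (hn3 _ _ _ (by simp) (by simp) hX (by tauto) (by tauto) (by tauto))
      (hn3 _ _ _ (by simp) (by simp) hX (by tauto) (by tauto) (by tauto))
  obtain ⟨δ, hδ⟩ := exists_vecMul_eq hABC D.rep
  obtain ⟨ε, hε⟩ := exists_vecMul_eq hABC E.rep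
  obtain ⟨φ, hφ⟩ := exists_vecMul_eq hABC F.rep
  have hδ0 := hco D (by simp) (by tauto) (by tauto) (by tauto) δ hδ
  have hε0 := hco E (by simp) (by tauto) (by tauto) (by tauto) ε hε
  have hφ0 := hco F (by simp) (by tauto) (by tauto) (by tauto) φ hφ
  have hmin := minors_ne_zero hδ hε
      (hn3 _ _ _ (by simp) (by simp) (by simp) (by tauto) (by tauto) (by tauto))
      (hn3 _ _ _ (by simp) (by simp) (by simp) (by tauto) (by tauto) (by tauto))
      (hn3 _ _ _ (by simp) (by simp) (by simp) (by tauto) (by tauto) (by tauto))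
  obtain ⟨hKA, hKB, hKC, hKD, hKE, hKF⟩ := honK
  obtain ⟨α, β, γ, hconic⟩ : ∃ α β γ : ℂ, ∀ u, eval (u ᵥ* of ![A.rep, B.rep, C.rep]) K =
      γ * (u 0 * u 1) + β * (u 0 * u 2) + α * (u 1 * u 2) := by
    refine ⟨eval (B.rep + C.rep) K, eval (A.rep + C.rep) K, eval (A.rep + B.rep) K, fun u => ?_⟩
    obtain ⟨q, hq⟩ := exists_quadratic_of_isHomogeneous_two hKh
    rw [hq] at hKA hKB hKC
    rw [vecMul_of_three]
    simp [hq]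
    linear_combination (u 0 ^ 2 - u 0 * u 1 - u 0 * u 2) * hKA +
      (u 1 ^ 2 - u 0 * u 1 - u 1 * u 2) * hKB + (u 2 ^ 2 - u 0 * u 2 - u 1 * u 2) * hKC
  rw [hδ, hconic] at hKD
  rw [hε, hconic] at hKE
  rw [hφ, hconic] at hKF
  have hne : ¬ (α = 0 ∧ β = 0 ∧ γ = 0) := by
    rintro ⟨rfl, rfl, rfl⟩
    refine hK0 (MvPolynomial.funext fun v => ?_)
    obtain ⟨u, rfl⟩ := exists_vecMul_eq hABC v
    rw [hconic]
    simp
  have hα : α ≠ 0 := by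
    rintro rfl
    exact hne ⟨rfl, conic_coeffs_eq_zero (by linear_combination hKD) (by linear_combination hKE)
      hδ0.1 hε0.1 hmin.1⟩
  have hβ : β ≠ 0 := by
    rintro rfl
    obtain ⟨h, h'⟩ := conic_coeffs_eq_zero (β := α) (γ := γ) (d₁ := δ 1) (e₁ := ε 1)
      (by linear_combination hKD) (by linear_combination hKE) hδ0.2.1 hε0.2.1 hmin.2.1
    exact hne ⟨h, rfl, h'⟩
  have hγ : γ ≠ 0 := by
    rintro rfl
    obtain ⟨h, h'⟩ := conic_coeffs_eq_zero (β := α) (γ := β) (d₁ := δ 2) (e₁ := ε 2)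
      (by linear_combination hKD) (by linear_combination hKE) hδ0.2.2 hε0.2.2 hmin.2.2
    exact hne ⟨h, h', rfl⟩
  refine ⟨_, ?_, ?_, ?_, ?_, _, _, _, isParam_of_coords hα hβ hγ hδ hKD hδ0,
    isParam_of_coords hα hβ hγ hε hKE hε0, isParam_of_coords hα hβ hγ hφ hKF hφ0⟩
  · have : (of ![α • A.rep, γ • C.rep - α • A.rep - β • B.rep, β • B.rep]).det =
        -(α * β * γ) * (of ![A.rep, B.rep, C.rep]).det := by
      simp [det_fin_three]
      ring
    rw [this]
    exact mul_ne_zero (neg_ne_zero.2 (by simp [*])) hABC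
  · refine ⟨α⁻¹, inv_ne_zero hα, ?_⟩
    rw [vecMul_of_three]
    simp [veronese, hα]
  · refine ⟨β⁻¹, inv_ne_zero hβ, ?_⟩
    rw [vecMul_of_three]
    simp [veronese, hβ]
  · refine ⟨γ⁻¹, inv_ne_zero hγ, ?_⟩
    rw [vecMul_of_three]
    ext i
    simp [veronese]
    field_simp
    ring

/-- The line through two Kirkman points and a Steiner point, written in three ways as a combination
of two Pascal lines. -/
lemma kirkman_steiner_combination (d e f : ℂ) :
    ((-d + d * f - e * f + d * e) * (d * (e - f))) •
        pascalVec (1, 0) (0, 1) (d, 1) (f, 1) (e, 1) (1, 1) +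
      ((d - f + e * f - d * f) * (f * (1 - d))) •
        pascalVec (1, 0) (0, 1) (f, 1) (d, 1) (1, 1) (e, 1) =
    ((d - f + e * f - d * f) * (e * (1 - d))) •
        pascalVec (1, 0) (0, 1) (e, 1) (d, 1) (1, 1) (f, 1) +
      ((-d + d * f - e * f + d * e) * (e - f)) •
        pascalVec (1, 0) (0, 1) (1, 1) (f, 1) (e, 1) (d, 1) ∧
    ((-d + d * f - e * f + d * e) * (d - f)) •
        pascalVec (1, 0) (1, 1) (0, 1) (f, 1) (d, 1) (e, 1) +
      ((d - f + e * f - d * f) * (d * (1 - e))) •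
        pascalVec (1, 0) (1, 1) (e, 1) (d, 1) (0, 1) (f, 1) =
    ((d - f + e * f - d * f) * (e * (1 - d))) •
        pascalVec (1, 0) (0, 1) (e, 1) (d, 1) (1, 1) (f, 1) +
      ((-d + d * f - e * f + d * e) * (e - f)) •
        pascalVec (1, 0) (0, 1) (1, 1) (f, 1) (e, 1) (d, 1) := by
  constructor <;> ext i <;> fin_cases i <;> simp [pascalVec, middleCoeffs, chord] <;> ring

/-- The degenerate case in which the two Kirkman points and the Steiner point lie on one common
Pascal line. -/
lemma pascalVec_eq_of_degenerate {d e f : ℂ} (hf : f ≠ 0) (h : d - f + e * f - d * f = 0) :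
    (d * (e - f)) • pascalVec (1, 0) (0, 1) (d, 1) (f, 1) (e, 1) (1, 1) =
      (d - f) • pascalVec (1, 0) (1, 1) (0, 1) (f, 1) (d, 1) (e, 1) ∧
    (d * (e - f)) • pascalVec (1, 0) (0, 1) (d, 1) (f, 1) (e, 1) (1, 1) =
      (e - f) • pascalVec (1, 0) (0, 1) (1, 1) (f, 1) (e, 1) (d, 1) := by
  obtain ⟨t, rfl⟩ : ∃ t, d = t * f := ⟨d / f, by field_simp⟩
  obtain rfl : e = 1 - t * (1 - f) := mul_right_cancel₀ hf (by linear_combination h)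
  constructor <;> ext i <;> fin_cases i <;> simp [pascalVec, middleCoeffs, chord] <;> ring

lemma add_smul_ne_zero {p q : Poly3} (hp : p ≠ 0) (h : ¬ ProportionalTo p q) {a : ℂ} (ha : a ≠ 0)
    (b : ℂ) : a • p + b • q ≠ 0 := by
  intro h0
  by_cases hb : b = 0
  · subst hb
    simp [ha, hp] at h0
  · refine h ⟨-(a / b), neg_ne_zero.2 (div_ne_zero ha hb), ?_⟩
    rw [neg_smul, div_eq_inv_mul, mul_smul, eq_neg_of_add_eq_zero_left h0, smul_neg, neg_neg,
      inv_smul_smul₀ hb]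

/-- The two Kirkman points `p₁ ∩ q₁` and `p₂ ∩ q₂` and the Steiner point `p₄ ∩ q₄`
are collinear. -/
theorem two_kirkman_one_steiner_collinear (A B C D E F : ProjPlane)
    (hdist : ([A, B, C, D, E, F] : List ProjPlane).Pairwise (· ≠ ·))
    (K : Poly3) (hKh : K.IsHomogeneous 2) (hKirr : Irreducible K)
    (honK : ∀ p ∈ [A, B, C, D, E, F], VanishesAt K p)
    (hn3 : NoThreeCollinear {A, B, C, D, E, F})
    (lAB lAC lAD lAE lAF lBC lBD lBE lBF lCD lCE lCF lDE lDF lEF : Poly3)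
    (hlAB : IsLineThrough lAB A B) (hlAC : IsLineThrough lAC A C)
    (hlAD : IsLineThrough lAD A D) (hlAE : IsLineThrough lAE A E)
    (hlAF : IsLineThrough lAF A F) (hlBC : IsLineThrough lBC B C)
    (hlBD : IsLineThrough lBD B D) (hlBE : IsLineThrough lBE B E)
    (hlBF : IsLineThrough lBF B F) (hlCD : IsLineThrough lCD C D)
    (hlCE : IsLineThrough lCE C E) (hlCF : IsLineThrough lCF C F)
    (hlDE : IsLineThrough lDE D E) (hlDF : IsLineThrough lDF D F)
    (hlEF : IsLineThrough lEF E F)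
    (p₁ p₂ p₄ q₁ q₂ q₄ : Poly3)
    (hp₁ : IsGenPascalLine A B C D E F (lAB * lDF * lCE) (lAC * lEF * lBD) p₁)
    (hp₂ : IsGenPascalLine A B C D E F (lAC * lBF * lDE) (lAE * lBC * lDF) p₂)
    (hp₄ : IsGenPascalLine A B C D E F (lAB * lDE * lCF) (lAF * lBE * lCD) p₄)
    (hq₁ : IsGenPascalLine A B C D E F (lAB * lDF * lCE) (lAE * lBF * lCD) q₁)
    (hq₂ : IsGenPascalLine A B C D E F (lAC * lBF * lDE) (lAF * lBD * lCE) q₂)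
    (hq₄ : IsGenPascalLine A B C D E F (lAB * lDE * lCF) (lAD * lBC * lEF) q₄)
    (hne₁ : ¬ ProportionalTo p₁ q₁) (hne₂ : ¬ ProportionalTo p₂ q₂)
    (hne₄ : ¬ ProportionalTo p₄ q₄)
    (K₁ K₂ St : ProjPlane)
    (hK₁ : VanishesAt p₁ K₁ ∧ VanishesAt q₁ K₁)
    (hK₂ : VanishesAt p₂ K₂ ∧ VanishesAt q₂ K₂)
    (hSt : VanishesAt p₄ St ∧ VanishesAt q₄ St) :
    Collin {K₁, K₂, St} := by
  obtain ⟨M, hM, hA, hB, hC, d, e, f, hD, hE, hF⟩ := exists_isParam hdist hKh hKirr.ne_zero honK hn3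
  simp only [List.pairwise_cons, List.mem_cons, List.not_mem_nil, or_false, forall_eq_or_imp,
    forall_eq] at hdist
  have hd : d ≠ 0 := by
    simpa [bracket] using hB.bracket_ne_zero hD (by tauto)
  have he : e ≠ 0 := by
    simpa [bracket] using hB.bracket_ne_zero hE (by tauto)
  have hf : f ≠ 0 := by
    simpa [bracket] using hB.bracket_ne_zero hF (by tauto)
  have hd1 : 1 - d ≠ 0 := by
    simpa [bracket] using hC.bracket_ne_zero hD (by tauto)
  have hef : e - f ≠ 0 := by
    simpa [bracket] using hE.bracket_ne_zero hF (by tauto)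
  obtain ⟨a₁, ha₁, ep₁⟩ := hp₁.exists_eval_eq hM hA hB hD hF hE hC (by simp)
    (by simp [hdist, eq_comm]) hlAB hlDF hlCE.symm hlBD hlEF.symm hlAC.symm (by ring) (by ring)
  obtain ⟨a₂, ha₂, ep₂⟩ := hp₂.exists_eval_eq hM hA hC hB hF hD hE (by simp)
    (by simp [hdist, eq_comm]) hlAC hlBF hlDE hlBC.symm hlDF.symm hlAE.symm (by ring) (by ring)
  obtain ⟨a₄, ha₄, ep₄⟩ := hp₄.exists_eval_eq hM hA hB hE hD hC hF (by simp)
    (by simp [hdist, eq_comm]) hlAB hlDE.symm hlCF hlBE hlCD.symm hlAF.symm (by ring) (by ring)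
  obtain ⟨b₁, hb₁, eq₁⟩ := hq₁.exists_eval_eq hM hA hB hF hD hC hE (by simp)
    (by simp [hdist, eq_comm]) hlAB hlDF.symm hlCE hlBF hlCD.symm hlAE.symm (by ring) (by ring)
  obtain ⟨b₂, hb₂, eq₂⟩ := hq₂.exists_eval_eq hM hA hC hE hD hB hF (by simp)
    (by simp [hdist, eq_comm]) hlAC hlDE.symm hlBF hlCE hlBD.symm hlAF.symm (by ring) (by ring)
  obtain ⟨b₄, hb₄, eq₄⟩ := hq₄.exists_eval_eq hM hA hB hC hF hE hD (by simp)
    (by simp [hdist, eq_comm]) hlAB hlCF hlDE.symm hlBC hlEF.symm hlAD.symm (by ring) (by ring)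
  obtain ⟨x, hx⟩ := exists_vecMul_eq hM K₁.rep
  obtain ⟨y, hy⟩ := exists_vecMul_eq hM K₂.rep
  obtain ⟨z, hz⟩ := exists_vecMul_eq hM St.rep
  simp only [VanishesAt, hx, hy, hz, ep₁, ep₂, ep₄, eq₁, eq₂, eq₄, mul_eq_zero, ha₁, ha₂, ha₄, hb₁,
    hb₂, hb₄, false_or] at hK₁ hK₂ hSt
  by_cases hS : d - f + e * f - d * f = 0
  · obtain ⟨h₂, h₄⟩ := pascalVec_eq_of_degenerate hf hS
    replace h₂ := congrArg (· ⬝ᵥ y) h₂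
    replace h₄ := congrArg (· ⬝ᵥ z) h₄
    simp only [smul_dotProduct, hK₂.1, hSt.2, smul_eq_mul, mul_zero, mul_eq_zero, hd, hef,
      false_or] at h₂ h₄
    refine ⟨p₁, hp₁.2.1, hp₁.2.2.1, ?_⟩
    rintro _ (rfl | rfl | rfl)
    · rw [VanishesAt, hx, ep₁, hK₁.1, mul_zero]
    · rw [VanishesAt, hy, ep₁, h₂, mul_zero]
    · rw [VanishesAt, hz, ep₁, h₄, mul_zero]
  · obtain ⟨h₁, h₂⟩ := kirkman_steiner_combination d e f
    replace h₁ := congrArg (· ⬝ᵥ x) h₁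
    replace h₂ := congrArg (· ⬝ᵥ y) h₂
    simp only [add_dotProduct, smul_dotProduct, hK₁, hK₂, smul_eq_mul, mul_zero, add_zero]
      at h₁ h₂
    refine ⟨((d - f + e * f - d * f) * (e * (1 - d)) / a₄) • p₄ +
        ((-d + d * f - e * f + d * e) * (e - f) / b₄) • q₄,
      add_smul_ne_zero hp₄.2.1 hne₄ (by simp [hS, he, hd1, ha₄]) _,
      (homogeneousSubmodule (Fin 3) ℂ 1).add_mem
        ((homogeneousSubmodule (Fin 3) ℂ 1).smul_mem _ hp₄.2.2.1)
        ((homogeneousSubmodule (Fin 3) ℂ 1).smul_mem _ hq₄.2.2.1), ?_⟩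
    rintro _ (rfl | rfl | rfl)
    · rw [VanishesAt, hx, map_add, smul_eval, smul_eval, ep₄, eq₄, ← mul_assoc (_ / a₄),
        ← mul_assoc (_ / b₄), div_mul_cancel₀ _ ha₄, div_mul_cancel₀ _ hb₄, ← h₁]
    · rw [VanishesAt, hy, map_add, smul_eval, smul_eval, ep₄, eq₄, ← mul_assoc (_ / a₄),
        ← mul_assoc (_ / b₄), div_mul_cancel₀ _ ha₄, div_mul_cancel₀ _ hb₄, ← h₂]
    · rw [VanishesAt, hz, map_add, smul_eval, smul_eval, ep₄, eq₄, hSt.1, hSt.2]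
      simp
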